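/- For every m > 0, Ω > 0, σ > 0, R_max > 0, and every tolerance ε ∈ (0, 1), there exists a finite truncation index K ∈ ℕ such that ∑_{k>K} 2 e^{−σ² k²/2} I_{k,m}(r) ≤ ε for every r ∈ [0, R_max]. -/

import Mathlib

open Real

/-- The Pochhammer symbol `(x)_n = x (x+1) ⋯ (x+n−1)` over the reals. -/
noncomputable def poch (x : ℝ) (n : ℕ) : ℝ := (ascPochhammer ℝ n).eval x

/-- The confluent hypergeometric function of the first kind
`₁F₁(a; b; z) = ∑ₙ ((a)ₙ / (b)ₙ) zⁿ / n!`. -/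
noncomputable def oneF1 (a b z : ℝ) : ℝ :=
  ∑' n : ℕ, poch a n / poch b n * z ^ n / (n.factorial : ℝ)

/-- `I_{k,m}(r) = (Γ(m + k/2) / (2 β^{m+k/2} k!)) r^k ₁F₁(m + k/2; k+1; r²/β)`,
where `β = 1 + m/Ω`. -/
noncomputable def Ikm (m Ω : ℝ) (k : ℕ) (r : ℝ) : ℝ :=
  Real.Gamma (m + (k : ℝ) / 2) /
      (2 * (1 + m / Ω) ^ (m + (k : ℝ) / 2) * (k.factorial : ℝ)) * r ^ k *
    oneF1 (m + (k : ℝ) / 2) ((k : ℝ) + 1) (r ^ 2 / (1 + m / Ω))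

open Filter Topology

lemma poch_zero (x : ℝ) : poch x 0 = 1 := by simp [poch]

lemma poch_succ (x : ℝ) (n : ℕ) : poch x (n + 1) = poch x n * (x + n) := by
  simp [poch, ascPochhammer_succ_eval]

lemma poch_pos {x : ℝ} (hx : 0 < x) (n : ℕ) : 0 < poch x n :=
  ascPochhammer_pos n x hx

/-- If `a ≤ c b` with `c ≥ 1`, then `(a)ₙ / (b)ₙ ≤ cⁿ`. -/
lemma poch_div_le {a b c : ℝ} (ha : 0 < a) (hb : 0 < b) (hc : 1 ≤ c) (hab : a ≤ c * b) (n : ℕ) :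
    poch a n / poch b n ≤ c ^ n := by
  rw [div_le_iff₀ (poch_pos hb n)]
  induction n with
  | zero => simp [poch_zero]
  | succ n ih =>
    have hn : (0 : ℝ) ≤ n := n.cast_nonneg
    have h : a + n ≤ c * (b + n) := by nlinarith
    calc poch a (n + 1) = poch a n * (a + n) := poch_succ a n
      _ ≤ c ^ n * poch b n * (c * (b + n)) :=
        mul_le_mul ih h (by positivity) (mul_nonneg (by positivity) (poch_pos hb n).le)
      _ = c ^ (n + 1) * poch b (n + 1) := by rw [poch_succ]; ring

lemma oneF1_nonneg {a b z : ℝ} (ha : 0 < a) (hb : 0 < b) (hz : 0 ≤ z) : 0 ≤ oneF1 a b z :=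
  tsum_nonneg fun n => by
    have := poch_pos ha n
    have := poch_pos hb n
    positivity

lemma oneF1_le_exp {a b c z : ℝ} (ha : 0 < a) (hb : 0 < b) (hc : 1 ≤ c) (hab : a ≤ c * b)
    (hz : 0 ≤ z) : oneF1 a b z ≤ Real.exp (c * z) := by
  have hle (n : ℕ) : poch a n / poch b n * z ^ n / (n.factorial : ℝ) ≤
      (c * z) ^ n / (n.factorial : ℝ) := by
    rw [mul_pow]
    have := poch_div_le ha hb hc hab n
    gcongr
  have hs : Summable fun n : ℕ => (c * z) ^ n / (n.factorial : ℝ) :=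
    Real.summable_pow_div_factorial _
  have hexp : Real.exp (c * z) = ∑' n : ℕ, (c * z) ^ n / (n.factorial : ℝ) := by
    rw [Real.exp_eq_exp_ℝ, NormedSpace.exp_eq_tsum_div]
  rw [hexp]
  refine (Summable.of_nonneg_of_le (fun n => ?_) hle hs).tsum_le_tsum hle hs
  have := poch_pos ha n
  have := poch_pos hb n
  positivity

/-- The quotients `Γ(m + k/2) / k!` grow at most geometrically in `k`. -/
lemma exists_Gamma_div_factorial_le {m : ℝ} (hm : 0 < m) :
    ∃ C : ℝ, 0 < C ∧ ∀ k : ℕ,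
      Real.Gamma (m + (k : ℝ) / 2) / (k.factorial : ℝ) ≤ C * (m + 1) ^ k := by
  have h0 : 0 < Real.Gamma m := Real.Gamma_pos_of_pos hm
  have h1 : 0 < Real.Gamma (m + 1 / 2) := Real.Gamma_pos_of_pos (by positivity)
  refine ⟨Real.Gamma m + Real.Gamma (m + 1 / 2), by positivity, fun k => ?_⟩
  induction k using Nat.twoStepInduction with
  | zero => simpa using h1.le
  | one =>
    simp only [Nat.cast_one, Nat.factorial_one, div_one, pow_one]
    nlinarith [mul_pos h0 hm, mul_pos h1 hm]
  | more k ih _ =>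
    have hk : (0 : ℝ) ≤ k := k.cast_nonneg
    have hs : 0 < m + (k : ℝ) / 2 := by positivity
    have hG : m + ((k + 2 : ℕ) : ℝ) / 2 = (m + (k : ℝ) / 2) + 1 := by push_cast; ring
    have hf : ((k + 2).factorial : ℝ) = ((k + 2) * (k + 1)) * (k.factorial : ℝ) := by
      rw [Nat.factorial_succ, Nat.factorial_succ]; push_cast; ring
    have hq : (m + (k : ℝ) / 2) / ((k + 2) * (k + 1)) ≤ (m + 1) ^ 2 := by
      rw [div_le_iff₀ (by positivity)]
      have e1 : m + (k : ℝ) / 2 ≤ (m + 1) * ((k + 2) * (k + 1)) := by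
        nlinarith [mul_nonneg hm.le hk, mul_nonneg hm.le (mul_nonneg hk hk), mul_nonneg hk hk]
      have e2 : (m + 1) ≤ (m + 1) ^ 2 := by nlinarith
      exact e1.trans (by gcongr)
    have hGp : 0 ≤ Real.Gamma (m + (k : ℝ) / 2) / (k.factorial : ℝ) :=
      div_nonneg (Real.Gamma_pos_of_pos hs).le (by positivity)
    rw [hG, Real.Gamma_add_one hs.ne', hf, mul_div_mul_comm]
    calc _ ≤ (m + 1) ^ 2 * ((Real.Gamma m + Real.Gamma (m + 1 / 2)) * (m + 1) ^ k) := by gcongr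
      _ = _ := by ring

/-- A Gaussian factor makes any geometric growth summable. -/
lemma summable_pow_mul_exp_neg_sq {A σ : ℝ} (hA : 0 ≤ A) (hσ : 0 < σ) :
    Summable fun k : ℕ => A ^ k * Real.exp (-(σ ^ 2 * (k : ℝ) ^ 2) / 2) := by
  have hlim : Tendsto (fun k : ℕ => A * Real.exp (-(σ ^ 2 / 2 * (k : ℝ)))) atTop (𝓝 (A * 0)) :=
    (Real.tendsto_exp_neg_atTop_nhds_zero.comp
      (tendsto_natCast_atTop_atTop.const_mul_atTop (by positivity))).const_mul A
  rw [mul_zero] at hlim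
  refine Summable.of_norm_bounded_eventually_nat summable_geometric_two ?_
  filter_upwards [hlim.eventually_le_const (by norm_num : (0 : ℝ) < 1 / 2)] with k hk
  have h : A ^ k * Real.exp (-(σ ^ 2 * (k : ℝ) ^ 2) / 2) =
      (A * Real.exp (-(σ ^ 2 / 2 * (k : ℝ)))) ^ k := by
    rw [mul_pow, ← Real.exp_nat_mul]
    congr 2
    ring
  rw [h, Real.norm_of_nonneg (by positivity)]
  gcongr

lemma Ikm_nonneg {m Ω r : ℝ} (hm : 0 < m) (hΩ : 0 < Ω) (hr : 0 ≤ r) (k : ℕ) :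
    0 ≤ Ikm m Ω k r := by
  have hs : 0 < m + (k : ℝ) / 2 := by positivity
  have := Real.Gamma_pos_of_pos hs
  have := oneF1_nonneg hs (by positivity : (0 : ℝ) < k + 1)
    (by positivity : 0 ≤ r ^ 2 / (1 + m / Ω))
  unfold Ikm
  positivity

lemma exists_Ikm_le {m Ω R : ℝ} (hm : 0 < m) (hΩ : 0 < Ω) :
    ∃ D : ℝ, ∀ k : ℕ, ∀ r ∈ Set.Icc 0 R, Ikm m Ω k r ≤ D * ((m + 1) * R) ^ k := by
  obtain ⟨C, hC, hCk⟩ := exists_Gamma_div_factorial_le hm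
  refine ⟨C * Real.exp ((m + 1) * R ^ 2), fun k r ⟨hr, hrR⟩ => ?_⟩
  have hk : (0 : ℝ) ≤ k := k.cast_nonneg
  have hs : 0 < m + (k : ℝ) / 2 := by positivity
  have hΓ := Real.Gamma_pos_of_pos hs
  have hβ : 1 ≤ 1 + m / Ω := le_add_of_nonneg_right (by positivity)
  have hz : r ^ 2 / (1 + m / Ω) ≤ R ^ 2 :=
    (div_le_self (by positivity) hβ).trans (by gcongr)
  have hF : oneF1 (m + (k : ℝ) / 2) ((k : ℝ) + 1) (r ^ 2 / (1 + m / Ω)) ≤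
      Real.exp ((m + 1) * R ^ 2) :=
    (oneF1_le_exp hs (by positivity) (by linarith : 1 ≤ m + 1)
      (by nlinarith [mul_nonneg hm.le hk]) (by positivity)).trans (by gcongr)
  have hpow : 1 ≤ (1 + m / Ω) ^ (m + (k : ℝ) / 2) := Real.one_le_rpow hβ hs.le
  have hG : Real.Gamma (m + (k : ℝ) / 2) /
      (2 * (1 + m / Ω) ^ (m + (k : ℝ) / 2) * (k.factorial : ℝ)) ≤ C * (m + 1) ^ k := by
    refine le_trans ?_ (hCk k)
    gcongr
    exact le_mul_of_one_le_left (by positivity) (by linarith)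
  have hR : 0 ≤ R := hr.trans hrR
  have hF0 := oneF1_nonneg hs (by positivity : (0 : ℝ) < k + 1)
    (by positivity : 0 ≤ r ^ 2 / (1 + m / Ω))
  unfold Ikm
  calc _ ≤ C * (m + 1) ^ k * R ^ k * Real.exp ((m + 1) * R ^ 2) := by gcongr
    _ = _ := by rw [mul_pow]; ring

/-- For every `m > 0`, `Ω > 0`, `σ > 0`, `R_max > 0`, and tolerance `ε ∈ (0, 1)`,
there exists a finite truncation index `K ∈ ℕ` such that the series tail satisfies
`∑_{k>K} 2 e^{−σ² k²/2} I_{k,m}(r) ≤ ε` for every `r ∈ [0, R_max]`. -/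
theorem mlg_series_truncation_exists (m Ω σ Rmax ε : ℝ) (hm : 0 < m) (hΩ : 0 < Ω)
    (hσ : 0 < σ) (hR : 0 < Rmax) (hε : ε ∈ Set.Ioo (0:ℝ) 1) :
    ∃ K : ℕ, ∀ r ∈ Set.Icc (0:ℝ) Rmax,
      (∑' j : ℕ, 2 * Real.exp (-(σ ^ 2 * ((K + 1 + j : ℕ) : ℝ) ^ 2) / 2) *
          Ikm m Ω (K + 1 + j) r) ≤ ε := by
  obtain ⟨D, hD⟩ := exists_Ikm_le (R := Rmax) hm hΩ
  set f : ℕ → ℝ := fun k =>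
    2 * D * (((m + 1) * Rmax) ^ k * Real.exp (-(σ ^ 2 * (k : ℝ) ^ 2) / 2)) with hf
  have hfs : Summable f := (summable_pow_mul_exp_neg_sq (by positivity) hσ).mul_left _
  obtain ⟨K, hK⟩ := ((tendsto_sum_nat_add f).comp (tendsto_add_atTop_nat 1)
    |>.eventually_le_const hε.1).exists
  refine ⟨K, fun r hr => ?_⟩
  have hle (k : ℕ) :
      2 * Real.exp (-(σ ^ 2 * (k : ℝ) ^ 2) / 2) * Ikm m Ω k r ≤ f k := by
    calc _ ≤ 2 * Real.exp (-(σ ^ 2 * (k : ℝ) ^ 2) / 2) * (D * ((m + 1) * Rmax) ^ k) := by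
          gcongr
          exact hD k r hr
      _ = f k := by simp only [hf]; ring
  have hgs : Summable fun j : ℕ => f (K + 1 + j) := by
    simpa only [add_comm] using (summable_nat_add_iff (K + 1)).2 hfs
  refine (Summable.tsum_le_tsum (fun j => hle (K + 1 + j))
    (Summable.of_nonneg_of_le (fun j => ?_) (fun j => hle (K + 1 + j)) hgs) hgs).trans ?_
  · exact mul_nonneg (by positivity) (Ikm_nonneg hm hΩ hr.1 _)
  · refine le_trans (le_of_eq ?_) hK
    exact tsum_congr fun j => by rw [add_comm]
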